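/- In End(ℂ[x]), for all L, R ∈ ℕ with L + R ≥ 1 and all n ∈ ℕ, one has the normal-ordering identity (C^L ∘ A ∘ C^R)^n = C^{en} ∘ (Σ_{k=0}^{n} S_{n,k}(−e, 1; R) · C^k ∘ A^k), where e = L + R − 1 ∈ ℕ is the excess and the coefficients S_{n,k}(−e, 1; R) ∈ ℂ use the parameters −e and R viewed as complex numbers. -/

import Mathlib

/-- The Hsu–Shiue generalized Stirling numbers `S_{n,k}(α,β;r)`, defined by the
triangular recurrence `S_{0,0} = 1`, `S_{0,k+1} = 0`, `S_{n+1,0} = (r − αn) S_{n,0}`,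
`S_{n+1,k+1} = (−αn + β(k+1) + r) S_{n,k+1} + S_{n,k}` (whence `S_{n,k} = 0` for `k > n`). -/
noncomputable def HS (α β r : ℂ) : ℕ → ℕ → ℂ
  | 0, 0 => 1
  | 0, _ + 1 => 0
  | n + 1, 0 => (r - α * n) * HS α β r n 0
  | n + 1, k + 1 => (-(α * n) + β * (k + 1) + r) * HS α β r n (k + 1) + HS α β r n k

open Polynomial

/-- The differentiation operator `d/dx` on `ℂ[x]`, as a `ℂ`-linear endomorphism. -/
noncomputable def A : Module.End ℂ (Polynomial ℂ) := Polynomial.derivative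

/-- The operator of multiplication by `x` on `ℂ[x]`, as a `ℂ`-linear endomorphism. -/
noncomputable def C : Module.End ℂ (Polynomial ℂ) := LinearMap.mulLeft ℂ Polynomial.X

theorem HS_eq_zero_of_lt (α β r : ℂ) {n k : ℕ} (h : n < k) : HS α β r n k = 0 := by
  induction n generalizing k with
  | zero =>
    obtain ⟨k, rfl⟩ := Nat.exists_eq_succ_of_ne_zero h.ne'
    simp [HS]
  | succ n ih =>
    obtain ⟨k, rfl⟩ := Nat.exists_eq_succ_of_ne_zero (Nat.ne_zero_of_lt h)
    simp [HS, ih (show n < k by lia), ih (show n < k + 1 by lia)]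

/-- The triangular recurrence, paired with an arbitrary sequence of vectors. -/
theorem sum_HS_succ {M : Type*} [AddCommMonoid M] [Module ℂ M] (α β r : ℂ) (n : ℕ) (X : ℕ → M) :
    ∑ k ∈ Finset.range (n + 1 + 1), HS α β r (n + 1) k • X k =
      ∑ k ∈ Finset.range (n + 1),
        HS α β r n k • (X (k + 1) + (-(α * n) + β * k + r) • X k) := by
  have key : ∑ k ∈ Finset.range (n + 1), HS α β r n k • (-(α * n) + β * k + r) • X k =
      ∑ k ∈ Finset.range (n + 1 + 1), HS α β r n k • (-(α * n) + β * k + r) • X k := by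
    rw [Finset.sum_range_succ _ (n + 1), HS_eq_zero_of_lt α β r n.lt_succ_self, zero_smul,
      add_zero]
  simp_rw [smul_add]
  rw [Finset.sum_add_distrib, key, Finset.sum_range_succ', Finset.sum_range_succ' _ (n + 1),
    ← add_assoc, ← Finset.sum_add_distrib]
  congr 1
  · refine Finset.sum_congr rfl fun k _ => ?_
    simp only [HS]
    push_cast
    module
  · simp only [HS]
    push_cast
    module

theorem A_mul_C : A * C = C * A + 1 := by
  refine LinearMap.ext fun p => ?_
  simp [A, _root_.C, add_comm]

theorem A_mul_C_pow_succ (m : ℕ) :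
    A * C ^ (m + 1) = C ^ (m + 1) * A + ((m : ℂ) + 1) • C ^ m := by
  induction m with
  | zero => simp [A_mul_C]
  | succ m ih =>
    rw [pow_succ C (m + 1), ← mul_assoc, ih, add_mul, mul_assoc, A_mul_C, smul_mul_assoc,
      ← pow_succ, mul_add, mul_one, ← mul_assoc]
    push_cast
    module

theorem C_pow_mul_A_mul_C_pow (L m j : ℕ) (h : L + m = j + 1) :
    C ^ L * A * C ^ m = C ^ (j + 1) * A + (m : ℂ) • C ^ j := by
  cases m with
  | zero => simp [← h]
  | succ m =>
    obtain rfl : j = L + m := by lia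
    rw [mul_assoc, A_mul_C_pow_succ, mul_add, ← mul_assoc, ← pow_add, mul_smul_comm, ← pow_add]
    push_cast
    rfl

/-- Normal-ordering identity: for `L + R ≥ 1` and `e = L + R − 1`,
`(C^L ∘ A ∘ C^R)^n = C^{en} ∘ Σ_{k=0}^{n} S_{n,k}(−e, 1; R) C^k ∘ A^k`. -/
theorem normal_ordering (L R : ℕ) (hLR : 1 ≤ L + R) (n : ℕ) :
    (C ^ L * A * C ^ R) ^ n =
      C ^ ((L + R - 1) * n) *
        ∑ k ∈ Finset.range (n + 1),
          HS (-((L + R - 1 : ℕ) : ℂ)) 1 (R : ℂ) n k • (C ^ k * A ^ k) := by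
  obtain ⟨e, he⟩ : ∃ e, L + R = e + 1 := ⟨L + R - 1, by lia⟩
  rw [he, Nat.add_sub_cancel]
  induction n with
  | zero => simp [HS]
  | succ n ih =>
    rw [pow_succ', ih, sum_HS_succ, Finset.mul_sum, Finset.mul_sum, Finset.mul_sum]
    refine Finset.sum_congr rfl fun k _ => ?_
    simp only [mul_smul_comm]
    congr 1
    have h := C_pow_mul_A_mul_C_pow L (R + e * n + k) (e * (n + 1) + k) (by linarith)
    calc C ^ L * A * C ^ R * (C ^ (e * n) * (C ^ k * A ^ k))
        = C ^ L * A * C ^ (R + e * n + k) * A ^ k := by simp only [pow_add, mul_assoc]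
      _ = _ := by
        rw [h]
        generalize e * (n + 1) = d
        rw [add_mul, mul_add, add_assoc, pow_add, pow_succ' A, mul_smul_comm, smul_mul_assoc,
          pow_add C d k]
        simp only [mul_assoc]
        congr 2
        push_cast
        ring
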